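/- Fix t ∈ (0,1/4). For every α ∈ (π/2)ℤ, F^{(α)}(t) = 4·Σ_{m,l,p=1}^∞ (−1)^{l+p+m+1}·m·W^{(|α|+mπ/2)}_{2l,2p}(t), the triple sum converging absolutely. -/

import Mathlib

open Complex Real Set

noncomputable section

/-- A lattice point `(x,y)` viewed as the complex number `x + iy`. -/
def ptC (p : ℤ × ℤ) : ℂ := (p.1 : ℂ) + (p.2 : ℂ) * Complex.I

/-- A diagonal step on `ℤ²`. -/
def IsDiagStep (a b : ℤ × ℤ) : Prop :=
  b - a = (1, 1) ∨ b - a = (1, -1) ∨ b - a = (-1, -1) ∨ b - a = (-1, 1)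

/-- A rectilinear step on `ℤ²`. -/
def IsRectStep (a b : ℤ × ℤ) : Prop :=
  b - a = (1, 0) ∨ b - a = (-1, 0) ∨ b - a = (0, 1) ∨ b - a = (0, -1)

/-- `w` encodes a simple diagonal walk `(w₀, …, w_n)` as a list of length `n+1`. -/
def IsWalkList (w : List (ℤ × ℤ)) : Prop := w ≠ [] ∧ w.Chain' IsDiagStep

/-- Winding angle of the walk `w` around the origin up to time `i`. -/
def windTo (w : List (ℤ × ℤ)) (i : ℕ) : ℝ :=
  ∑ j ∈ Finset.range i, (ptC (w.getD (j + 1) 0) / ptC (w.getD j 0)).arg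

/-- The full winding angle of the walk `w` around the origin. -/
def wind (w : List (ℤ × ℤ)) : ℝ := windTo w (w.length - 1)

/-- The condition on walks counted by `W^{(α,I)}_{l,p}`: a simple diagonal walk on
`ℤ² ∖ {0}` from `(p,0)` to a point on one of the axes at distance `l` from the origin,
with full winding angle `α` and intermediate winding angles in `I`. -/
def WCond (l p : ℕ) (α : ℝ) (I : Set ℝ) (w : List (ℤ × ℤ)) : Prop :=
  IsWalkList w ∧ (∀ x ∈ w, x ≠ (0, 0)) ∧ w.head? = some ((p : ℤ), 0) ∧
    (w.getLast? = some ((l : ℤ), 0) ∨ w.getLast? = some (-(l : ℤ), 0) ∨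
      w.getLast? = some (0, (l : ℤ)) ∨ w.getLast? = some (0, -(l : ℤ))) ∧
    wind w = α ∧ (∀ i, 1 ≤ i → i ≤ w.length - 2 → windTo w i ∈ I)

/-- The generating function `W^{(α,I)}_{l,p}(t)`. -/
def Wgen (t : ℝ) (l p : ℕ) (α : ℝ) (I : Set ℝ) : ℝ :=
  ∑' w : {w : List (ℤ × ℤ) // WCond l p α I w}, t ^ (w.val.length - 1)

/-- The complete elliptic integral of the first kind `K(k)`. -/
def Kell (k : ℝ) : ℝ := ∫ y in (0:ℝ)..1, 1 / Real.sqrt ((1 - y ^ 2) * (1 - k ^ 2 * y ^ 2))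

/-- The complete elliptic integral of the second kind `E(k)`. -/
def Eell (k : ℝ) : ℝ := ∫ y in (0:ℝ)..1, Real.sqrt (1 - k ^ 2 * y ^ 2) / Real.sqrt (1 - y ^ 2)

/-- The complementary modulus `k' = √(1-k²)`. -/
def kComp (k : ℝ) : ℝ := Real.sqrt (1 - k ^ 2)

/-- The elliptic nome `q_k = exp(-π K(k')/K(k))`. -/
def qNome (k : ℝ) : ℝ := Real.exp (-π * Kell (kComp k) / Kell k)

/-- The descending Landen transformation `k₁ = (1-k')/(1+k')`. -/
def kLanden (k : ℝ) : ℝ := (1 - kComp k) / (1 + kComp k)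

/-- `T_k = K(k')/(4K(k))`. -/
def Tell (k : ℝ) : ℝ := Kell (kComp k) / (4 * Kell k)

/-- The plane minus the two real slits `{z ∈ ℝ : z² ≥ κ}`. -/
def slitDom (κ : ℝ) : Set ℂ := {z : ℂ | ¬(z.im = 0 ∧ κ ≤ z.re ^ 2)}

/-- `v` is the analytic function `v_κ` on `ℂ ∖ {z ∈ ℝ : z² ≥ κ}` with `v 0 = 0` and
`v'(z) = 1/(4K(κ)√((κ-z²)(1-κz²)))`, the branch of the square root being positive on
`(-√κ, √κ)` (by analytic continuation this determines `v` uniquely). -/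
structure IsVmap (κ : ℝ) (v : ℂ → ℂ) : Prop where
  map_zero : v 0 = 0
  analytic : AnalyticOnNhd ℂ v (slitDom κ)
  deriv_real : ∀ x : ℝ, x ^ 2 < κ →
    HasDerivAt v ((1 / (4 * Kell κ * Real.sqrt ((κ - x ^ 2) * (1 - κ * x ^ 2))) : ℝ) : ℂ)
      (x : ℂ)

/-- The function `f_m(z) = cos(2πm(v(z) + 1/4)) - cos(πm/2)` built from `v = v_{k₁}`. -/
def fmFun (v : ℂ → ℂ) (m : ℕ) (z : ℂ) : ℂ :=
  Complex.cos (2 * (π : ℂ) * m * (v z + 1 / 4)) - Complex.cos ((π : ℂ) * m / 2)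

/-- `a n m` is the (real) Taylor coefficient `[zⁿ] f_m(z)` at `0`. -/
def IsCoeff (κ : ℝ) (v : ℂ → ℂ) (a : ℕ → ℕ → ℝ) : Prop :=
  ∀ m : ℕ, 1 ≤ m → ∀ z : ℂ, z ∈ slitDom κ → ‖z‖ < 1 →
    HasSum (fun n : ℕ => (a n m : ℂ) * z ^ n) (fmFun v m z)

/-- An excursion: a nonempty simple diagonal walk from the origin to the origin with no
intermediate visits to the origin. -/
def IsExcursion (w : List (ℤ × ℤ)) : Prop :=
  2 ≤ w.length ∧ w.Chain' IsDiagStep ∧ w.head? = some (0, 0) ∧ w.getLast? = some (0, 0) ∧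
    ∀ i, 1 ≤ i → i ≤ w.length - 2 → w.getD i 0 ≠ (0, 0)

/-- The winding angle sequence of an excursion: `θ₀ = θ₁ = 0`, increments of the first and
last step do not contribute, and `θ_n = θ_{n-1}`. -/
def windExcTo (w : List (ℤ × ℤ)) (i : ℕ) : ℝ :=
  ∑ j ∈ Finset.Icc 2 (min i (w.length - 2)), (ptC (w.getD j 0) / ptC (w.getD (j - 1) 0)).arg

/-- The full winding angle of an excursion. -/
def windExc (w : List (ℤ × ℤ)) : ℝ := windExcTo w (w.length - 1)

/-- `F^{(α)}(t)`: generating function of excursions with winding angle `α`. -/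
def Fgen (t α : ℝ) : ℝ :=
  ∑' w : {w : List (ℤ × ℤ) // IsExcursion w ∧ windExc w = α}, t ^ (w.val.length - 1)

/-- `F(t,b) = Σ_w t^{|w|} e^{i b θ^w}`, the characteristic function of excursions. -/
def Fchar (t b : ℝ) : ℂ :=
  ∑' w : {w : List (ℤ × ℤ) // IsExcursion w},
    (t : ℂ) ^ (w.val.length - 1) * Complex.exp (Complex.I * b * windExc w.val)

/-- `ψ_k(z) = (1 - √(1-kz²))/(√k z)` (principal square root), `ψ_k(0) = 0`. -/
def psiK (k : ℝ) (z : ℂ) : ℂ :=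
  if z = 0 then 0 else (1 - (1 - (k : ℂ) * z ^ 2) ^ ((1 : ℂ) / 2)) / ((Real.sqrt k : ℂ) * z)

/-- The winding increment along the step from `a` to `b`. -/
def dl (a b : ℤ × ℤ) : ℝ := (ptC b / ptC a).arg

/-- The four diagonal steps. -/
def steps : Finset (ℤ × ℤ) := {(1, 1), (1, -1), (-1, -1), (-1, 1)}

/-- Rotation by a right angle. -/
def rot (a : ℤ × ℤ) : ℤ × ℤ := (-a.2, a.1)

/-- Reflection in the horizontal axis. -/
def mirror (a : ℤ × ℤ) : ℤ × ℤ := (a.1, -a.2)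

lemma isDiagStep_iff (a b : ℤ × ℤ) : IsDiagStep a b ↔ b - a ∈ steps := by
  simp [IsDiagStep, steps]

lemma sum_steps (f : ℤ × ℤ → ℝ) :
    ∑ s ∈ steps, f s = f (1, 1) + f (1, -1) + f (-1, -1) + f (-1, 1) := by
  simp [steps, add_assoc]

lemma sum_steps_rot (f : ℤ × ℤ → ℝ) : ∑ s ∈ steps, f (rot s) = ∑ s ∈ steps, f s := by
  simp only [sum_steps, rot, neg_neg]; ring

lemma sum_steps_mirror (f : ℤ × ℤ → ℝ) : ∑ s ∈ steps, f (mirror s) = ∑ s ∈ steps, f s := by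
  simp only [sum_steps, mirror, neg_neg]; ring

lemma sum_steps_neg (f : ℤ × ℤ → ℝ) : ∑ s ∈ steps, f (-s) = ∑ s ∈ steps, f s := by
  simp only [sum_steps, Prod.neg_mk, neg_neg]; ring

lemma ptC_re (a : ℤ × ℤ) : (ptC a).re = a.1 := by simp [ptC]

lemma ptC_im (a : ℤ × ℤ) : (ptC a).im = a.2 := by simp [ptC]

lemma ptC_rot (a : ℤ × ℤ) : ptC (rot a) = I * ptC a := by
  apply Complex.ext <;> simp [ptC, rot]

lemma ptC_mirror (a : ℤ × ℤ) : ptC (mirror a) = (starRingEnd ℂ) (ptC a) := by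
  apply Complex.ext <;> simp [ptC, mirror]

lemma ptC_ne_zero {a : ℤ × ℤ} (ha : a ≠ 0) : ptC a ≠ 0 := by
  intro h
  apply ha
  have h1 := congrArg Complex.re h
  have h2 := congrArg Complex.im h
  rw [ptC_re] at h1
  rw [ptC_im] at h2
  exact Prod.ext (by simpa using h1) (by simpa using h2)

lemma dl_rot (a b : ℤ × ℤ) : dl (rot a) (rot b) = dl a b := by
  rw [dl, dl, ptC_rot, ptC_rot, mul_div_mul_left _ _ I_ne_zero]

lemma dl_ne_pi (a : ℤ × ℤ) {s : ℤ × ℤ} (hs : s ∈ steps) : dl a (a + s) ≠ π := by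
  intro h
  rw [dl, Complex.arg_eq_pi_iff] at h
  obtain ⟨h1, h2⟩ := h
  by_cases ha : a = 0
  · subst ha; simp [ptC] at h1
  have hn : 0 < Complex.normSq (ptC a) := Complex.normSq_pos.2 (ptC_ne_zero ha)
  rw [Complex.div_re, ← add_div, div_lt_iff₀ hn, zero_mul] at h1
  rw [Complex.div_im, ← sub_div, div_eq_zero_iff, or_iff_left hn.ne'] at h2
  simp only [ptC_re, ptC_im] at h1 h2
  norm_cast at h1 h2
  obtain ⟨x, y⟩ := a
  simp only [steps, Finset.mem_insert, Finset.mem_singleton] at hs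
  rcases hs with rfl | rfl | rfl | rfl <;> simp only [Prod.mk_add_mk] at h1 h2
  · have : x = y := by linarith
    subst this
    rcases le_or_gt 0 x with h | h <;> nlinarith
  · have : x = -y := by linarith
    subst this
    rcases le_or_gt y 0 with h | h <;> nlinarith
  · have : x = y := by linarith
    subst this
    rcases le_or_gt x 0 with h | h <;> nlinarith
  · have : x = -y := by linarith
    subst this
    rcases le_or_gt 0 y with h | h <;> nlinarith

lemma dl_mirror (a : ℤ × ℤ) {s : ℤ × ℤ} (hs : s ∈ steps) :
    dl (mirror a) (mirror (a + s)) = -dl a (a + s) := by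
  have h := dl_ne_pi a hs
  rw [dl] at h
  rw [dl, dl, ptC_mirror, ptC_mirror, ← map_div₀, Complex.arg_conj, if_neg h]

lemma dl_symm (a : ℤ × ℤ) {s : ℤ × ℤ} (hs : s ∈ steps) : dl (a + s) a = -dl a (a + s) := by
  have h := dl_ne_pi a hs
  rw [dl] at h
  rw [dl, dl, ← inv_div, Complex.arg_inv, if_neg h]

lemma dl_axis (p : ℤ) (hp : 0 < p) (b : ℤ × ℤ) : dl (p, 0) b = (ptC b).arg := by
  have h : ptC b / ptC (p, 0) = ((p : ℝ)⁻¹ : ℝ) * ptC b := by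
    simp [ptC]; ring
  rw [dl, h, Complex.arg_real_mul _ (by positivity)]

lemma arg_ptC_mem {a : ℤ × ℤ} (ha : 0 < a.1) : |(ptC a).arg| < π / 2 :=
  Complex.abs_arg_lt_pi_div_two_iff.2 (Or.inl (by rw [ptC_re]; exact_mod_cast ha))

lemma dl_of_pos {a b : ℤ × ℤ} (ha : 0 < a.1) (hb : 0 < b.1) :
    dl a b = (ptC b).arg - (ptC a).arg := by
  have h1 := abs_lt.1 (arg_ptC_mem ha)
  have h2 := abs_lt.1 (arg_ptC_mem hb)
  have ha0 : ptC a ≠ 0 := ptC_ne_zero (by rintro rfl; simp at ha)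
  have hb0 : ptC b ≠ 0 := ptC_ne_zero (by rintro rfl; simp at hb)
  have hi : ((ptC a)⁻¹).arg = -(ptC a).arg := by
    rw [Complex.arg_inv, if_neg (by linarith [Real.pi_pos])]
  rw [dl, div_eq_mul_inv, Complex.arg_mul hb0 (inv_ne_zero ha0), hi, sub_eq_add_neg]
  rw [hi]
  constructor <;> linarith

lemma arg_ptC_one_one : (ptC (1, 1)).arg = π / 4 := by
  have h : ptC (1, 1) = ((Real.sqrt 2 : ℝ) : ℂ) *
      (Complex.cos ((π / 4 : ℝ) : ℂ) + Complex.sin ((π / 4 : ℝ) : ℂ) * I) := by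
    rw [← Complex.ofReal_cos, ← Complex.ofReal_sin, Real.cos_pi_div_four, Real.sin_pi_div_four]
    have h2 : Real.sqrt 2 * (Real.sqrt 2 / 2) = 1 := by
      rw [mul_div_assoc', Real.mul_self_sqrt (by norm_num)]; norm_num
    apply Complex.ext <;> simp [ptC, h2]
  rw [h]
  exact Complex.arg_mul_cos_add_sin_mul_I (by positivity)
    ⟨by linarith [Real.pi_pos], by linarith [Real.pi_pos]⟩

lemma arg_ptC_one_neg_one : (ptC (1, -1)).arg = -(π / 4) := by
  have h : ptC (1, -1) = (starRingEnd ℂ) (ptC (1, 1)) := by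
    rw [← ptC_mirror]; rfl
  rw [h, Complex.arg_conj, arg_ptC_one_one, if_neg (by linarith [Real.pi_pos])]

/-- The walks of length `n` from `a` to `b` avoiding the origin, with winding angle `θ`. -/
def walks : ℕ → ℤ × ℤ → ℤ × ℤ → ℝ → Finset (List (ℤ × ℤ))
  | 0, a, b, θ => if a = b ∧ θ = 0 ∧ a ≠ 0 then {[a]} else ∅
  | n + 1, a, b, θ => if a = 0 then ∅ else
      steps.biUnion fun s => (walks n (a + s) b (θ - dl a (a + s))).map
        ⟨List.cons a, List.cons_injective⟩

/-- The number of walks of length `n` from `a` to `b` with winding angle `θ`. -/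
def cnt (n : ℕ) (a b : ℤ × ℤ) (θ : ℝ) : ℝ := (walks n a b θ).card

lemma wind_cons_cons (a b : ℤ × ℤ) (l : List (ℤ × ℤ)) :
    wind (a :: b :: l) = dl a b + wind (b :: l) := by
  simp only [wind, windTo, List.length_cons, Nat.add_sub_cancel, Finset.sum_range_succ' _ l.length,
    dl]
  rw [add_comm]
  simp

lemma mem_walks {n : ℕ} {a b : ℤ × ℤ} {θ : ℝ} {w : List (ℤ × ℤ)} :
    w ∈ walks n a b θ ↔ w.length = n + 1 ∧ w.head? = some a ∧ w.getLast? = some b ∧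
      w.IsChain IsDiagStep ∧ (∀ x ∈ w, x ≠ (0, 0)) ∧ wind w = θ := by
  induction n generalizing a θ w with
  | zero =>
    rw [walks]
    match w with
    | [] => split_ifs <;> simp
    | [x] =>
      have : wind [x] = 0 := by simp [wind, windTo]
      rw [this]
      split_ifs with h
      · obtain ⟨rfl, rfl, h⟩ := h
        simp only [Finset.mem_singleton]
        constructor
        · intro h'
          cases h'
          refine ⟨rfl, rfl, rfl, List.isChain_singleton _, fun x hx => ?_, by simp⟩
          rw [List.mem_singleton.1 hx]
          exact h
        · rintro ⟨-, h, -⟩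
          simpa using h
      · simp only [Finset.notMem_empty, false_iff]
        rintro ⟨-, h1, h2, -, h3, h4⟩
        simp at h1 h2 h3
        subst h1 h2
        exact h ⟨rfl, h4.symm, h3⟩
    | x :: y :: l => split_ifs <;> simp
  | succ n ih =>
    rw [walks]
    match w with
    | [] => split_ifs <;> simp
    | [x] =>
      split_ifs
      · simp
      · simp only [Finset.mem_biUnion, Finset.mem_map, Function.Embedding.coeFn_mk]
        constructor
        · rintro ⟨s, -, l, hl, h⟩
          rw [ih] at hl
          obtain rfl : l = [] := by simpa using (List.cons.inj h).2
          simp at hl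
        · simp
    | x :: y :: l =>
      by_cases ha : a = 0
      · subst ha
        simp only [if_true, Finset.notMem_empty, false_iff]
        rintro ⟨-, h1, -, -, h2, -⟩
        simp at h1
        subst h1
        exact h2 0 (by simp) rfl
      rw [if_neg ha]
      simp only [Finset.mem_biUnion, Finset.mem_map, Function.Embedding.coeFn_mk]
      constructor
      · rintro ⟨s, hs, l', hl, h⟩
        cases h
        rw [ih] at hl
        obtain ⟨h1, h2, h3, h4, h5, h6⟩ := hl
        simp at h2
        subst h2
        refine ⟨by simpa using h1, rfl, by simpa using h3, ?_, ?_, ?_⟩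
        · refine List.isChain_cons_cons.2 ⟨?_, h4⟩
          rw [isDiagStep_iff]; simpa using hs
        · intro z hz
          rcases List.mem_cons.1 hz with rfl | hz
          · exact ha
          · exact h5 z hz
        · rw [wind_cons_cons, h6]; ring
      · rintro ⟨h1, h2, h3, h4, h5, h6⟩
        simp at h2
        subst h2
        obtain ⟨h7, h8⟩ := List.isChain_cons_cons.1 h4
        rw [isDiagStep_iff] at h7
        refine ⟨y - x, h7, y :: l, ?_, rfl⟩
        rw [ih]
        rw [wind_cons_cons] at h6
        refine ⟨by simpa using h1, by simp, by simpa using h3, h8,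
          fun z hz => h5 z (List.mem_cons_of_mem _ hz), ?_⟩
        rw [add_sub_cancel, ← h6]; ring

lemma cnt_nonneg (n : ℕ) (a b : ℤ × ℤ) (θ : ℝ) : 0 ≤ cnt n a b θ := Nat.cast_nonneg _

lemma cnt_zero (a b : ℤ × ℤ) (θ : ℝ) :
    cnt 0 a b θ = if a = b ∧ θ = 0 ∧ a ≠ 0 then 1 else 0 := by
  rw [cnt, walks]; split_ifs <;> simp

lemma cnt_zero_left (n : ℕ) (b : ℤ × ℤ) (θ : ℝ) : cnt n 0 b θ = 0 := by
  cases n <;> simp [cnt, walks]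

lemma cnt_succ (n : ℕ) {a : ℤ × ℤ} (ha : a ≠ 0) (b : ℤ × ℤ) (θ : ℝ) :
    cnt (n + 1) a b θ = ∑ s ∈ steps, cnt n (a + s) b (θ - dl a (a + s)) := by
  rw [cnt, walks, if_neg ha, Finset.card_biUnion]
  · simp [cnt]
  · intro s _ s' _ hss
    rw [Function.onFun, Finset.disjoint_left]
    intro w hw hw'
    simp only [Finset.mem_map, Function.Embedding.coeFn_mk] at hw hw'
    obtain ⟨l, hl, rfl⟩ := hw
    obtain ⟨l', hl', h⟩ := hw'
    obtain rfl : l' = l := by simpa using h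
    have h1 := (mem_walks.1 hl).2.1
    have h2 := (mem_walks.1 hl').2.1
    rw [h1] at h2
    exact hss (by simpa using h2)

lemma cnt_succ_right (n : ℕ) (a : ℤ × ℤ) {b : ℤ × ℤ} (hb : b ≠ 0) (θ : ℝ) :
    cnt (n + 1) a b θ = ∑ s ∈ steps, cnt n a (b + s) (θ - dl (b + s) b) := by
  induction n generalizing a θ with
  | zero =>
    by_cases ha : a = 0
    · subst ha; simp [cnt_zero_left]
    rw [cnt_succ _ ha, ← sum_steps_neg]
    refine Finset.sum_congr rfl fun s _ => ?_
    rw [cnt_zero, cnt_zero]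
    congr 1
    rw [eq_iff_iff]
    constructor
    · rintro ⟨rfl, h, -⟩
      exact ⟨by simp, by simpa using h, ha⟩
    · rintro ⟨rfl, h, -⟩
      exact ⟨by simp, by simpa using h, by simpa using hb⟩
  | succ n ih =>
    by_cases ha : a = 0
    · subst ha; simp [cnt_zero_left]
    rw [cnt_succ _ ha]
    simp_rw [ih, cnt_succ n ha]
    rw [Finset.sum_comm]
    simp_rw [sub_right_comm]

lemma rot_eq_zero {a : ℤ × ℤ} : rot a = 0 ↔ a = 0 := by
  simp [rot, Prod.ext_iff, and_comm]

lemma mirror_eq_zero {a : ℤ × ℤ} : mirror a = 0 ↔ a = 0 := by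
  simp [mirror, Prod.ext_iff]

lemma rot_add (a b : ℤ × ℤ) : rot (a + b) = rot a + rot b := by
  simp [rot, add_comm]

lemma mirror_add (a b : ℤ × ℤ) : mirror (a + b) = mirror a + mirror b := by
  simp [mirror, add_comm]

lemma rot_inj {a b : ℤ × ℤ} : rot a = rot b ↔ a = b := by
  simp [rot, Prod.ext_iff, and_comm]

lemma mirror_inj {a b : ℤ × ℤ} : mirror a = mirror b ↔ a = b := by
  simp [mirror, Prod.ext_iff]

lemma cnt_rot (n : ℕ) (a b : ℤ × ℤ) (θ : ℝ) : cnt n (rot a) (rot b) θ = cnt n a b θ := by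
  induction n generalizing a θ with
  | zero => simp only [cnt_zero, ne_eq, rot_eq_zero, rot_inj]
  | succ n ih =>
    by_cases ha : a = 0
    · subst ha; simp [cnt_zero_left, rot_eq_zero.2 rfl]
    rw [cnt_succ _ ha, cnt_succ _ (mt rot_eq_zero.1 ha), ← sum_steps_rot]
    simp_rw [← rot_add, ih, dl_rot]

lemma cnt_mirror (n : ℕ) (a b : ℤ × ℤ) (θ : ℝ) :
    cnt n (mirror a) (mirror b) (-θ) = cnt n a b θ := by
  induction n generalizing a θ with
  | zero => simp only [cnt_zero, ne_eq, mirror_eq_zero, mirror_inj, neg_eq_zero]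
  | succ n ih =>
    by_cases ha : a = 0
    · subst ha; simp [cnt_zero_left, mirror_eq_zero.2 rfl]
    rw [cnt_succ _ ha, cnt_succ _ (mt mirror_eq_zero.1 ha), ← sum_steps_mirror]
    refine Finset.sum_congr rfl fun s hs => ?_
    rw [← ih, ← mirror_add, dl_mirror a hs, neg_sub']

lemma cnt_zero_right (n : ℕ) (a : ℤ × ℤ) (θ : ℝ) : cnt n a 0 θ = 0 := by
  rw [cnt, Nat.cast_eq_zero, Finset.card_eq_zero, Finset.eq_empty_iff_forall_notMem]
  intro w hw
  obtain ⟨-, -, h, -, h', -⟩ := mem_walks.1 hw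
  exact h' 0 (List.mem_of_getLast? h) rfl

lemma cnt_reverse (n : ℕ) (a b : ℤ × ℤ) (θ : ℝ) : cnt n b a (-θ) = cnt n a b θ := by
  induction n generalizing a θ with
  | zero =>
    simp only [cnt_zero, neg_eq_zero]
    congr 1
    rw [eq_iff_iff]
    constructor <;> (rintro ⟨rfl, h⟩; exact ⟨rfl, h⟩)
  | succ n ih =>
    by_cases ha : a = 0
    · subst ha; simp [cnt_zero_left, cnt_zero_right]
    rw [cnt_succ _ ha, cnt_succ_right _ _ ha]
    refine Finset.sum_congr rfl fun s hs => ?_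
    rw [← ih, dl_symm a hs, neg_sub', sub_neg_eq_add]

lemma cnt_le (n : ℕ) (a b : ℤ × ℤ) (θ : ℝ) : cnt n a b θ ≤ 4 ^ n := by
  induction n generalizing a θ with
  | zero => rw [cnt_zero]; split_ifs <;> simp
  | succ n ih =>
    by_cases ha : a = 0
    · subst ha; rw [cnt_zero_left]; positivity
    rw [cnt_succ _ ha, sum_steps, pow_succ]
    linarith [ih (a + (1, 1)) (θ - dl a (a + (1, 1))), ih (a + (1, -1)) (θ - dl a (a + (1, -1))),
      ih (a + (-1, -1)) (θ - dl a (a + (-1, -1))), ih (a + (-1, 1)) (θ - dl a (a + (-1, 1)))]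

lemma exists_step_of_cnt_ne_zero {n : ℕ} {a b : ℤ × ℤ} {θ : ℝ} (h : cnt (n + 1) a b θ ≠ 0) :
    ∃ s ∈ steps, cnt n (a + s) b (θ - dl a (a + s)) ≠ 0 := by
  by_cases ha : a = 0
  · subst ha; exact absurd (cnt_zero_left _ _ _) h
  rw [cnt_succ _ ha] at h
  exact Finset.exists_ne_zero_of_sum_ne_zero h

lemma abs_of_mem_steps {s : ℤ × ℤ} (hs : s ∈ steps) : |s.1| = 1 ∧ |s.2| = 1 := by
  simp only [steps, Finset.mem_insert, Finset.mem_singleton] at hs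
  rcases hs with rfl | rfl | rfl | rfl <;> simp

lemma dist_le_of_cnt_ne_zero {n : ℕ} {a b : ℤ × ℤ} {θ : ℝ} (h : cnt n a b θ ≠ 0) :
    |a.1 - b.1| ≤ n ∧ |a.2 - b.2| ≤ n := by
  induction n generalizing a θ with
  | zero =>
    rw [cnt_zero] at h
    obtain ⟨rfl, -⟩ := (ite_ne_right_iff.1 h).1
    simp
  | succ n ih =>
    obtain ⟨s, hs, h⟩ := exists_step_of_cnt_ne_zero h
    obtain ⟨h1, h2⟩ := ih h
    obtain ⟨h3, h4⟩ := abs_of_mem_steps hs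
    simp only [Prod.fst_add, Prod.snd_add] at h1 h2
    push_cast
    rw [abs_le] at *
    grind

lemma abs_le_of_cnt_ne_zero {n : ℕ} {a b : ℤ × ℤ} {θ : ℝ} (h : cnt n a b θ ≠ 0) :
    |θ| ≤ n * π := by
  induction n generalizing a θ with
  | zero =>
    rw [cnt_zero] at h
    obtain ⟨-, rfl, -⟩ := (ite_ne_right_iff.1 h).1
    simp
  | succ n ih =>
    obtain ⟨s, hs, h⟩ := exists_step_of_cnt_ne_zero h
    have h1 := abs_le.1 (ih h)
    have h2 := abs_le.1 (Complex.abs_arg_le_pi (ptC (a + s) / ptC a))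
    rw [dl] at h1
    push_cast
    rw [abs_le]
    constructor <;> linarith

/-- A walk that starts too far to the right to reach the vertical axis winds by the difference of
the arguments of its endpoints. -/
lemma wind_of_cnt_ne_zero {n : ℕ} {a b : ℤ × ℤ} {θ : ℝ} (h : cnt n a b θ ≠ 0)
    (ha : (n : ℤ) < a.1) : 0 < b.1 ∧ θ = (ptC b).arg - (ptC a).arg := by
  induction n generalizing a θ with
  | zero =>
    rw [cnt_zero] at h
    obtain ⟨rfl, rfl, -⟩ := (ite_ne_right_iff.1 h).1
    simpa using ha
  | succ n ih =>
    obtain ⟨s, hs, h⟩ := exists_step_of_cnt_ne_zero h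
    have h3 := (abs_eq (by norm_num)).1 (abs_of_mem_steps hs).1
    push_cast at ha
    have h4 : (n : ℤ) < (a + s).1 := by rw [Prod.fst_add]; omega
    obtain ⟨h1, h2⟩ := ih h h4
    refine ⟨h1, ?_⟩
    rw [dl_of_pos (by omega) (by omega)] at h2
    linarith

/-- The axis point `(2(p+1), 0)`. -/
def axisPt (p : ℕ) : ℤ × ℤ := (((2 * (p + 1) : ℕ) : ℤ), 0)

lemma axisPt_ne_zero (p : ℕ) : axisPt p ≠ 0 := by
  intro h
  have := congrArg Prod.fst h
  simp only [axisPt, Prod.fst_zero] at this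
  omega

lemma sum_range_alternating (x : ℕ → ℝ) (P : ℕ) :
    ∑ p ∈ Finset.range P, (-1 : ℝ) ^ (p + 1) * (x p + x (p + 1)) = -x 0 + (-1) ^ P * x P := by
  induction P with
  | zero => simp
  | succ P ih => rw [Finset.sum_range_succ, ih]; ring

lemma cnt_succ_axisPt (n p : ℕ) (b : ℤ × ℤ) (θ : ℝ) (q : ℤ × ℤ → ℝ)
    (hq : ∀ z, q z = cnt n z b (θ - (ptC z).arg)) :
    cnt (n + 1) (axisPt p) b θ =
      (q (2 * (p : ℕ) + 1, 1) + q (2 * ((p + 1 : ℕ) : ℤ) + 1, 1)) +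
        (q (2 * (p : ℕ) + 1, -1) + q (2 * ((p + 1 : ℕ) : ℤ) + 1, -1)) := by
  have hp : (0 : ℤ) < ((2 * (p + 1) : ℕ) : ℤ) := by omega
  rw [cnt_succ n (axisPt_ne_zero p), sum_steps]
  simp only [axisPt, dl_axis _ hp, ← hq, Prod.mk_add_mk, zero_add]
  have h1 : ((2 * (p + 1) : ℕ) : ℤ) + 1 = 2 * ((p + 1 : ℕ) : ℤ) + 1 := by push_cast; ring
  have h2 : ((2 * (p + 1) : ℕ) : ℤ) + -1 = 2 * (p : ℤ) + 1 := by push_cast; ring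
  rw [h1, h2]
  ring

/-- In the alternating sum over starting points on a half-axis, the first steps cancel except for
those ending next to the origin. -/
lemma sum_cnt_axisPt (n : ℕ) (b : ℤ × ℤ) (θ : ℝ) (P : ℕ) (hP : b.1 + n < 2 * P + 1) :
    ∑ p ∈ Finset.range P, (-1 : ℝ) ^ (p + 1) * cnt (n + 1) (axisPt p) b θ =
      -(cnt n (1, 1) b (θ - π / 4) + cnt n (1, -1) b (θ + π / 4)) := by
  set q : ℤ × ℤ → ℝ := fun z => cnt n z b (θ - (ptC z).arg) with hq
  have h0 : ∀ j : ℤ, q (2 * (P : ℤ) + 1, j) = 0 := by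
    intro j
    by_contra h
    have := (abs_le.1 (dist_le_of_cnt_ne_zero h).1).2
    simp only at this
    omega
  simp_rw [cnt_succ_axisPt n _ b θ q fun _ => rfl, mul_add _ (_ + _) (_ + _),
    Finset.sum_add_distrib]
  rw [sum_range_alternating (fun p => q (2 * (p : ℤ) + 1, 1)),
    sum_range_alternating (fun p => q (2 * (p : ℤ) + 1, -1)), h0, h0]
  simp only [hq, Nat.cast_zero, mul_zero, zero_add, add_zero, arg_ptC_one_one,
    arg_ptC_one_neg_one, sub_neg_eq_add]
  ring

/-- The number of walks of length `n` from `a` to one of the four rotations of `b`, with winding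
angle `θ`. -/
def cntOrbit (n : ℕ) (a b : ℤ × ℤ) (θ : ℝ) : ℝ := ∑ k ∈ Finset.range 4, cnt n a (rot^[k] b) θ

lemma rot_iterate_four (a : ℤ × ℤ) : rot^[4] a = a := by simp [rot]

lemma rot_iterate_mirror (k : ℕ) (a : ℤ × ℤ) : rot^[k] (mirror (rot^[k] a)) = mirror a := by
  induction k with
  | zero => rfl
  | succ k ih =>
    rw [Function.iterate_succ_apply, Function.iterate_succ_apply', ← ih]
    simp [rot, mirror]

lemma cnt_rot_iterate (n k : ℕ) (a b : ℤ × ℤ) (θ : ℝ) :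
    cnt n (rot^[k] a) (rot^[k] b) θ = cnt n a b θ := by
  induction k with
  | zero => rfl
  | succ k ih => rw [Function.iterate_succ_apply', Function.iterate_succ_apply', cnt_rot, ih]

lemma cntOrbit_rot_right (n : ℕ) (a b : ℤ × ℤ) (θ : ℝ) :
    cntOrbit n a (rot b) θ = cntOrbit n a b θ := by
  simp only [cntOrbit, ← Function.iterate_succ_apply]
  rw [Finset.sum_range_succ, Finset.sum_range_succ' _ 3, rot_iterate_four]
  rfl

lemma cntOrbit_rot_left (n : ℕ) (a b : ℤ × ℤ) (θ : ℝ) :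
    cntOrbit n (rot a) b θ = cntOrbit n a b θ := by
  rw [← cntOrbit_rot_right]
  simp only [cntOrbit, ← Function.iterate_succ_apply, Function.iterate_succ_apply', cnt_rot]

lemma cntOrbit_mirror (n : ℕ) (a b : ℤ × ℤ) (θ : ℝ) :
    cntOrbit n a b θ = cntOrbit n (mirror b) (mirror a) θ := by
  refine Finset.sum_congr rfl fun k _ => ?_
  rw [← cnt_reverse, ← cnt_mirror, neg_neg, ← cnt_rot_iterate n k, rot_iterate_mirror]

lemma cntOrbit_nonneg (n : ℕ) (a b : ℤ × ℤ) (θ : ℝ) : 0 ≤ cntOrbit n a b θ :=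
  Finset.sum_nonneg fun _ _ => cnt_nonneg _ _ _ _

lemma cntOrbit_le (n : ℕ) (a b : ℤ × ℤ) (θ : ℝ) : cntOrbit n a b θ ≤ 4 * 4 ^ n := by
  refine (Finset.sum_le_card_nsmul _ _ (4 ^ n) fun _ _ => cnt_le _ _ _ _).trans ?_
  simp

lemma exists_of_cntOrbit_ne_zero {n : ℕ} {a b : ℤ × ℤ} {θ : ℝ} (h : cntOrbit n a b θ ≠ 0) :
    ∃ k, cnt n a (rot^[k] b) θ ≠ 0 := by
  obtain ⟨k, -, hk⟩ := Finset.exists_ne_zero_of_sum_ne_zero h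
  exact ⟨k, hk⟩

/-- The number of walks of length `n` from `(1,1)` to any of its rotations, with winding
angle `θ`. -/
def cornerCnt (n : ℕ) (θ : ℝ) : ℝ := cntOrbit n (1, 1) (1, 1) θ

lemma cornerCnt_neg (n : ℕ) (θ : ℝ) : cornerCnt n (-θ) = cornerCnt n θ := by
  have h1 : cnt n (-1, 1) (1, 1) θ = cnt n (1, 1) (1, -1) θ := by
    simpa [rot] using cnt_rot n (1, 1) (1, -1) θ
  have h2 : cnt n (1, -1) (1, 1) θ = cnt n (1, 1) (-1, 1) θ := by
    simpa [rot] using (cnt_rot n (1, -1) (1, 1) θ).symm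
  have h3 : cnt n (-1, -1) (1, 1) θ = cnt n (1, 1) (-1, -1) θ := by
    simpa [rot] using cnt_rot_iterate n 2 (1, 1) (-1, -1) θ
  have h (b) : cnt n (1, 1) b (-θ) = cnt n b (1, 1) θ := cnt_reverse n b (1, 1) θ
  simp only [cornerCnt, cntOrbit, h, Finset.sum_range_succ, Finset.sum_range_zero,
    Function.iterate_succ_apply, Function.iterate_zero_apply, rot, neg_neg, h1, h2, h3]
  ring

lemma cornerCnt_eq_zero {n : ℕ} {θ : ℝ} (h : n * π < |θ|) : cornerCnt n θ = 0 := by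
  by_contra h'
  obtain ⟨k, hk⟩ := exists_of_cntOrbit_ne_zero h'
  exact absurd (abs_le_of_cnt_ne_zero hk) (not_le.2 h)

lemma sum_cntOrbit_axisPt (n : ℕ) (b : ℤ × ℤ) (θ : ℝ) (P : ℕ)
    (hP : ∀ k, (rot^[k] b).1 + n < 2 * P + 1) :
    ∑ p ∈ Finset.range P, (-1 : ℝ) ^ (p + 1) * cntOrbit (n + 1) (axisPt p) b θ =
      -(cntOrbit n (1, 1) b (θ - π / 4) + cntOrbit n (1, 1) b (θ + π / 4)) := by
  have h : rot (1, -1) = (1, 1) := rfl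
  nth_rw 2 [← h]
  rw [cntOrbit_rot_left]
  simp only [cntOrbit, Finset.mul_sum]
  rw [Finset.sum_comm]
  simp_rw [sum_cnt_axisPt n _ θ P (hP _)]
  rw [Finset.sum_neg_distrib, Finset.sum_add_distrib]

lemma cntOrbit_corner_axisPt (n l : ℕ) (θ : ℝ) :
    cntOrbit n (1, 1) (axisPt l) θ = cntOrbit n (axisPt l) (1, 1) θ := by
  have h : rot (mirror (1, 1)) = (1, 1) := rfl
  have h' : mirror (axisPt l) = axisPt l := rfl
  rw [cntOrbit_mirror, ← cntOrbit_rot_right, h, h']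

lemma max_abs_rot_iterate (k : ℕ) (b : ℤ × ℤ) :
    max |(rot^[k] b).1| |(rot^[k] b).2| = max |b.1| |b.2| := by
  induction k with
  | zero => rfl
  | succ k ih =>
    rw [Function.iterate_succ_apply', ← ih, max_comm]
    simp [rot]

lemma max_abs_axisPt (p : ℕ) : max |(axisPt p).1| |(axisPt p).2| = 2 * (p + 1) := by
  simp only [axisPt, abs_zero]
  rw [max_eq_left (abs_nonneg _), Nat.abs_cast]
  push_cast; rfl

lemma sum_sum_cntOrbit (n : ℕ) (θ : ℝ) (L P : ℕ) (hL : n < 2 * L) (hP : 2 * L + n < 2 * P) :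
    ∑ l ∈ Finset.range L, ∑ p ∈ Finset.range P,
      (-1 : ℝ) ^ (l + 1) * ((-1) ^ (p + 1) * cntOrbit (n + 2) (axisPt p) (axisPt l) θ) =
      cornerCnt n (θ - π / 2) + 2 * cornerCnt n θ + cornerCnt n (θ + π / 2) := by
  have h1 : ∀ l ∈ Finset.range L, ∑ p ∈ Finset.range P,
      (-1 : ℝ) ^ (l + 1) * ((-1) ^ (p + 1) * cntOrbit (n + 2) (axisPt p) (axisPt l) θ) =
      -((-1 : ℝ) ^ (l + 1) * cntOrbit (n + 1) (axisPt l) (1, 1) (θ - π / 4)) -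
        (-1 : ℝ) ^ (l + 1) * cntOrbit (n + 1) (axisPt l) (1, 1) (θ + π / 4) := by
    intro l hl
    rw [Finset.mem_range] at hl
    rw [← Finset.mul_sum, sum_cntOrbit_axisPt (n + 1), cntOrbit_corner_axisPt,
      cntOrbit_corner_axisPt]
    · ring
    · intro k
      have h := max_abs_rot_iterate k (axisPt l)
      rw [max_abs_axisPt] at h
      have h' := (le_abs_self _).trans ((le_max_left _ _).trans h.le)
      push_cast
      omega
  have h2 : ∀ k, (rot^[k] (1, 1)).1 + (n : ℤ) < 2 * L + 1 := by
    intro k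
    have h := (le_abs_self _).trans ((le_max_left _ _).trans (max_abs_rot_iterate k (1, 1)).le)
    simp only [abs_one, max_self] at h
    omega
  rw [Finset.sum_congr rfl h1, Finset.sum_sub_distrib, Finset.sum_neg_distrib,
    sum_cntOrbit_axisPt n _ _ L h2, sum_cntOrbit_axisPt n _ _ L h2]
  change -(-(cornerCnt n _ + cornerCnt n _)) - -(cornerCnt n _ + cornerCnt n _) = _
  have e1 : θ - π / 4 - π / 4 = θ - π / 2 := by ring
  have e2 : θ + π / 4 + π / 4 = θ + π / 2 := by ring
  rw [e1, e2, sub_add_cancel, add_sub_cancel_right]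
  ring

lemma sum_range_alternating_mul (G : ℕ → ℝ) (M : ℕ) :
    ∑ m ∈ Finset.range M, (-1 : ℝ) ^ m * (m + 1) * (G m + 2 * G (m + 1) + G (m + 2)) =
      G 0 - (-1) ^ M * ((M + 1) * G M + M * G (M + 1)) := by
  induction M with
  | zero => simp
  | succ M ih => rw [Finset.sum_range_succ, ih]; push_cast; ring

lemma lt_of_cntOrbit_axisPt_ne_zero {n l p : ℕ} {θ : ℝ} (hθ : π / 2 ≤ θ)
    (h : cntOrbit n (axisPt p) (axisPt l) θ ≠ 0) : p + 1 < n ∧ l < n ∧ θ ≤ n * π := by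
  obtain ⟨k, hk⟩ := exists_of_cntOrbit_ne_zero h
  have hp : 2 * (p + 1) ≤ n := by
    by_contra! hlt
    obtain ⟨h1, h2⟩ := wind_of_cnt_ne_zero hk (by simp only [axisPt]; exact_mod_cast hlt)
    have h3 : (ptC (axisPt p)).arg = 0 := by
      rw [Complex.arg_eq_zero_iff, ptC_re, ptC_im]
      simp only [axisPt]
      exact ⟨by positivity, by simp⟩
    have h4 := (abs_lt.1 (arg_ptC_mem h1)).2
    linarith
  refine ⟨by omega, ?_, (le_abs_self θ).trans (abs_le_of_cnt_ne_zero hk)⟩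
  obtain ⟨h1, h2⟩ := dist_le_of_cnt_ne_zero hk
  have h3 := (max_abs_rot_iterate k (axisPt l)).trans (max_abs_axisPt l)
  generalize rot^[k] (axisPt l) = b at h1 h2 h3
  simp only [axisPt, abs_le] at h1 h2
  have h4 : max |b.1| |b.2| ≤ 2 * (p + 1) + n := by
    refine max_le ?_ ?_ <;> rw [abs_le] <;> constructor <;> omega
  omega

/-- The pieces, sorted by the length `n` of the walks, of the term of the triple series with index
`x = (m, l, p)`. -/
def seriesTerm (t β : ℝ) (n : ℕ) (x : ℕ × ℕ × ℕ) : ℝ :=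
  (-1 : ℝ) ^ ((x.2.1 + 1) + (x.2.2 + 1) + (x.1 + 1) + 1) * ((x.1 : ℝ) + 1) *
    (cntOrbit n (axisPt x.2.2) (axisPt x.2.1) (β + (x.1 + 1) * π / 2) * t ^ n)

/-- A box containing the indices of all nonzero terms coming from walks of length `n`. -/
def seriesBox (n : ℕ) : Finset (ℕ × ℕ × ℕ) :=
  Finset.range (2 * n + 2) ×ˢ Finset.range (2 * n + 2) ×ˢ Finset.range (4 * n + 8)

lemma seriesTerm_support {t β : ℝ} (hβ : 0 ≤ β) {n : ℕ} {x : ℕ × ℕ × ℕ}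
    (h : seriesTerm t β n x ≠ 0) : x ∈ seriesBox n ∧ 2 ≤ n := by
  have h1 : cntOrbit n (axisPt x.2.2) (axisPt x.2.1) (β + (x.1 + 1) * π / 2) ≠ 0 := by
    intro h0
    exact h (by rw [seriesTerm, h0]; ring)
  have hx : (0 : ℝ) ≤ x.1 * π := by positivity
  obtain ⟨h2, h3, h4⟩ := lt_of_cntOrbit_axisPt_ne_zero (by linarith) h1
  have h5 : x.1 < 2 * n + 2 := by
    have : (x.1 : ℝ) * π < (2 * n + 2) * π := by nlinarith [Real.pi_pos]
    exact_mod_cast lt_of_mul_lt_mul_right this Real.pi_pos.le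
  simp only [seriesBox, Finset.mem_product, Finset.mem_range]
  omega

lemma abs_seriesTerm_le {t : ℝ} (ht : 0 ≤ t) {β : ℝ} {n : ℕ} {x : ℕ × ℕ × ℕ}
    (hx : x ∈ seriesBox n) : |seriesTerm t β n x| ≤ (2 * n + 2) * 4 * (4 * t) ^ n := by
  have h : (x.1 : ℝ) + 1 ≤ 2 * n + 2 := by
    simp only [seriesBox, Finset.mem_product, Finset.mem_range] at hx
    exact_mod_cast hx.1
  rw [seriesTerm, abs_mul, abs_mul, abs_pow, abs_neg, abs_one, one_pow, one_mul,
    abs_of_nonneg (by positivity : (0 : ℝ) ≤ x.1 + 1),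
    abs_of_nonneg (mul_nonneg (cntOrbit_nonneg _ _ _ _) (pow_nonneg ht n))]
  calc _ ≤ (2 * n + 2 : ℝ) * (4 * 4 ^ n * t ^ n) :=
        mul_le_mul h (mul_le_mul_of_nonneg_right (cntOrbit_le _ _ _ _) (pow_nonneg ht n))
          (mul_nonneg (cntOrbit_nonneg _ _ _ _) (pow_nonneg ht n)) (by positivity)
    _ = _ := by rw [mul_pow]; ring

lemma summable_of_finset_support {X : Type*} (F : ℕ × X → ℝ) (B : ℕ → Finset X) (b : ℕ → ℝ)
    (hB : ∀ n x, F (n, x) ≠ 0 → x ∈ B n) (hb : ∀ n, ∀ x ∈ B n, |F (n, x)| ≤ b n)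
    (hs : Summable fun n => (B n).card * b n) : Summable F := by
  have h0 : ∀ n, ∀ x ∉ B n, |F (n, x)| = 0 := fun n x hx => by
    rw [abs_eq_zero]; exact not_not.1 (mt (hB n x) hx)
  rw [← summable_abs_iff, summable_prod_of_nonneg fun _ => abs_nonneg _]
  refine ⟨fun n => summable_of_ne_finset_zero (h0 n), ?_⟩
  refine Summable.of_nonneg_of_le (fun n => tsum_nonneg fun _ => abs_nonneg _) (fun n => ?_) hs
  rw [tsum_eq_sum (h0 n), ← nsmul_eq_mul]
  exact Finset.sum_le_card_nsmul _ _ _ (hb n)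

lemma summable_pow_mul_four_mul_pow {t : ℝ} (ht : t ∈ Set.Ioo (0 : ℝ) (1 / 4)) (k : ℕ) :
    Summable fun n : ℕ => (n : ℝ) ^ k * (4 * t) ^ n := by
  refine summable_pow_mul_geometric_of_norm_lt_one k ?_
  rw [Real.norm_eq_abs, abs_lt]
  constructor <;> linarith [ht.1, ht.2]

lemma summable_seriesTerm {t : ℝ} (ht : t ∈ Set.Ioo (0 : ℝ) (1 / 4)) {β : ℝ} (hβ : 0 ≤ β) :
    Summable fun y : ℕ × ℕ × ℕ × ℕ => seriesTerm t β y.1 y.2 := by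
  refine summable_of_finset_support _ seriesBox _ (fun n x h => (seriesTerm_support hβ h).1)
    (fun n x hx => abs_seriesTerm_le ht.1.le hx) ?_
  have h := summable_pow_mul_four_mul_pow ht
  refine ((((((h 4).mul_left 128).add ((h 3).mul_left 640)).add ((h 2).mul_left 1152)).add
    ((h 1).mul_left 896)).add ((h 0).mul_left 256)).congr fun n => ?_
  simp only [seriesBox, Finset.card_product, Finset.card_range]
  push_cast
  ring

lemma tsum_seriesTerm_of_lt {t β : ℝ} (hβ : 0 ≤ β) {n : ℕ} (hn : n < 2) :
    ∑' x, seriesTerm t β n x = 0 := by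
  have h : ∀ x, seriesTerm t β n x = 0 := fun x => by
    by_contra h
    exact absurd (seriesTerm_support hβ h).2 (not_le.2 hn)
  simp [h]

lemma tsum_seriesTerm_add_two {t β : ℝ} (hβ : 0 ≤ β) (n : ℕ) :
    ∑' x, seriesTerm t β (n + 2) x = cornerCnt n β * t ^ (n + 2) := by
  rw [tsum_eq_sum (s := seriesBox (n + 2))
    fun x hx => not_not.1 (mt (fun h => (seriesTerm_support hβ h).1) hx)]
  set M := 2 * (n + 2) + 2 with hM
  have hG : ∀ j, M ≤ j → cornerCnt n (β + j * π / 2) = 0 := by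
    intro j hj
    apply cornerCnt_eq_zero
    have : ((2 * n + 6 : ℕ) : ℝ) * π ≤ j * π := by gcongr; omega
    push_cast at this
    rw [abs_of_nonneg (by positivity)]
    nlinarith [Real.pi_pos]
  have h1 : ∀ m : ℕ, ∑ y ∈ Finset.range M ×ˢ Finset.range (4 * (n + 2) + 8),
      seriesTerm t β (n + 2) (m, y) = (-1 : ℝ) ^ m * (m + 1) *
        (cornerCnt n (β + (m : ℕ) * π / 2) + 2 * cornerCnt n (β + (m + 1 : ℕ) * π / 2) +
          cornerCnt n (β + (m + 2 : ℕ) * π / 2)) * t ^ (n + 2) := by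
    intro m
    have e0 : β + (m : ℕ) * π / 2 = β + ((m : ℝ) + 1) * π / 2 - π / 2 := by ring
    have e1 : β + (m + 1 : ℕ) * π / 2 = β + ((m : ℝ) + 1) * π / 2 := by push_cast; ring
    have e2 : β + (m + 2 : ℕ) * π / 2 = β + ((m : ℝ) + 1) * π / 2 + π / 2 := by push_cast; ring
    rw [e0, e1, e2, ← sum_sum_cntOrbit n _ M (4 * (n + 2) + 8) (by omega) (by omega),
      Finset.sum_product, Finset.mul_sum, Finset.sum_mul]
    refine Finset.sum_congr rfl fun l _ => ?_
    rw [Finset.mul_sum, Finset.sum_mul]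
    refine Finset.sum_congr rfl fun p _ => ?_
    simp only [seriesTerm]
    ring
  rw [seriesBox, Finset.sum_product]
  simp_rw [← hM, h1]
  rw [← Finset.sum_mul, sum_range_alternating_mul fun j => cornerCnt n (β + j * π / 2), hG M le_rfl,
    hG (M + 1) (by omega)]
  simp

/-- A generating function of lists whose coefficients are given by a counting sequence. -/
lemma tsum_pow_length (t : ℝ) (ht : 0 ≤ t) (Q : List (ℤ × ℤ) → Prop) (c : ℕ → ℝ)
    (s : ℕ → Finset (List (ℤ × ℤ))) (hmem : ∀ n w, w ∈ s n ↔ Q w ∧ w.length - 1 = n)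
    (hcard : ∀ n, ((s n).card : ℝ) = c n) (hs : Summable fun n => c n * t ^ n) :
    ∑' w : {w // Q w}, t ^ (w.val.length - 1) = ∑' n, c n * t ^ n := by
  let e := Equiv.sigmaFiberEquiv fun w : {w // Q w} => w.val.length - 1
  rw [← e.tsum_eq]
  have hval : ∀ y, t ^ ((e y).val.length - 1) = t ^ y.1 := fun y => by
    rw [← y.2.2]; rfl
  have hcd : ∀ n, ∃ _ : Fintype {w : {w // Q w} // w.val.length - 1 = n},
      (Fintype.card {w : {w // Q w} // w.val.length - 1 = n} : ℝ) = c n := by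
    intro n
    let e' : {w : {w // Q w} // w.val.length - 1 = n} ≃ s n :=
      (Equiv.subtypeSubtypeEquivSubtypeInter Q fun w => w.length - 1 = n).trans
        (Equiv.subtypeEquivRight fun w => (hmem n w).symm)
    let _ := Fintype.ofEquiv _ e'.symm
    exact ⟨inferInstance, by rw [← hcard n, Fintype.card_congr e', Fintype.card_coe]⟩
  choose hf hc using hcd
  simp_rw [hval]
  have hfib : ∀ n, ∑' _ : {w : {w // Q w} // w.val.length - 1 = n}, t ^ n = c n * t ^ n := by
    intro n
    rw [tsum_fintype, Finset.sum_const, Finset.card_univ, nsmul_eq_mul, hc]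
  rw [Summable.tsum_sigma]
  · exact tsum_congr hfib
  · rw [summable_sigma_of_nonneg fun _ => pow_nonneg ht _]
    refine ⟨fun n => Summable.of_finite, ?_⟩
    simpa only [hfib] using hs

lemma rot_iterate_injOn {b : ℤ × ℤ} (hb : b ≠ 0) {k k' : ℕ} (hk : k < 4) (hk' : k' < 4)
    (h : rot^[k] b = rot^[k'] b) : k = k' := by
  obtain ⟨x, y⟩ := b
  have hxy : x ≠ 0 ∨ y ≠ 0 := by
    by_contra! h0
    exact hb (by rw [h0.1, h0.2]; rfl)
  interval_cases k <;> interval_cases k' <;> simp [rot] at h ⊢ <;> omega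

/-- The walks of length `n` from `a` to one of the four rotations of `b`, with winding
angle `θ`. -/
def orbitWalks (n : ℕ) (a b : ℤ × ℤ) (θ : ℝ) : Finset (List (ℤ × ℤ)) :=
  (Finset.range 4).biUnion fun k => walks n a (rot^[k] b) θ

lemma mem_orbitWalks {n : ℕ} {a b : ℤ × ℤ} {θ : ℝ} {w : List (ℤ × ℤ)} :
    w ∈ orbitWalks n a b θ ↔ ∃ k < 4, w ∈ walks n a (rot^[k] b) θ := by
  simp [orbitWalks]

lemma card_orbitWalks (n : ℕ) (a : ℤ × ℤ) {b : ℤ × ℤ} (hb : b ≠ 0) (θ : ℝ) :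
    ((orbitWalks n a b θ).card : ℝ) = cntOrbit n a b θ := by
  rw [orbitWalks, Finset.card_biUnion]
  · simp [cntOrbit, cnt]
  · intro k hk k' hk' hkk
    rw [Function.onFun, Finset.disjoint_left]
    intro w hw hw'
    have h := (mem_walks.1 hw).2.2.1.symm.trans (mem_walks.1 hw').2.2.1
    exact hkk (rot_iterate_injOn hb (by simpa using hk) (by simpa using hk')
      (by simpa using h))

lemma summable_mul_pow_of_le {t : ℝ} (ht : t ∈ Set.Ioo (0 : ℝ) (1 / 4)) {c : ℕ → ℝ} (C : ℝ)
    (h0 : ∀ n, 0 ≤ c n) (hc : ∀ n, c n ≤ C * 4 ^ n) : Summable fun n => c n * t ^ n := by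
  refine Summable.of_nonneg_of_le (fun n => mul_nonneg (h0 n) (pow_nonneg ht.1.le n)) (fun n => ?_)
    ((summable_pow_mul_four_mul_pow ht 0).mul_left C)
  rw [pow_zero, one_mul, mul_pow, ← mul_assoc]
  exact mul_le_mul_of_nonneg_right (hc n) (pow_nonneg ht.1.le n)

lemma Wgen_eq {t : ℝ} (ht : t ∈ Set.Ioo (0 : ℝ) (1 / 4)) (l p : ℕ) (θ : ℝ) :
    Wgen t (2 * (l + 1)) (2 * (p + 1)) θ Set.univ =
      ∑' n, cntOrbit n (axisPt p) (axisPt l) θ * t ^ n := by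
  refine tsum_pow_length t ht.1.le _ _ (fun n => orbitWalks n (axisPt p) (axisPt l) θ) ?_
    (fun n => card_orbitWalks n _ (axisPt_ne_zero l) θ)
    (summable_mul_pow_of_le ht 4 (fun _ => cntOrbit_nonneg _ _ _ _) fun _ => cntOrbit_le _ _ _ _)
  intro n w
  have hk : ∀ x : Option (ℤ × ℤ), (∃ k < 4, x = some (rot^[k] (axisPt l))) ↔
      (x = some (((2 * (l + 1) : ℕ) : ℤ), 0) ∨ x = some (-((2 * (l + 1) : ℕ) : ℤ), 0) ∨
        x = some (0, ((2 * (l + 1) : ℕ) : ℤ)) ∨ x = some (0, -((2 * (l + 1) : ℕ) : ℤ))) := by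
    intro x
    constructor
    · rintro ⟨k, hk, rfl⟩
      interval_cases k <;> simp [rot, axisPt]
    · rintro (rfl | rfl | rfl | rfl)
      · exact ⟨0, by simp [axisPt]⟩
      · exact ⟨2, by simp [axisPt, rot]⟩
      · exact ⟨1, by simp [axisPt, rot]⟩
      · exact ⟨3, by simp [axisPt, rot]⟩
  rw [mem_orbitWalks, WCond, ← hk]
  constructor
  · rintro ⟨k, hk, hw⟩
    obtain ⟨h1, h2, h3, h4, h5, h6⟩ := mem_walks.1 hw
    refine ⟨⟨⟨?_, h4⟩, h5, h2, ⟨k, hk, h3⟩, h6, fun _ _ _ => Set.mem_univ _⟩, by omega⟩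
    rintro rfl
    simp at h1
  · rintro ⟨⟨⟨h1, h2⟩, h3, h4, ⟨k, hk, h5⟩, h6, -⟩, h7⟩
    have := List.length_pos_iff.2 h1
    exact ⟨k, hk, mem_walks.2 ⟨by omega, h4, h5, h2, h3, h6⟩⟩

/-- Extend a walk by a first step from the origin and a last step to the origin. -/
def closeUp (v : List (ℤ × ℤ)) : List (ℤ × ℤ) := 0 :: (v ++ [0])

lemma closeUp_injective : Function.Injective closeUp := fun v v' h => by
  simpa [closeUp] using h

lemma windExc_closeUp {n : ℕ} {v : List (ℤ × ℤ)} (hv : v.length = n + 1) :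
    windExc (closeUp v) = wind v := by
  have h1 : min ((closeUp v).length - 1) ((closeUp v).length - 2) = n + 1 := by
    simp [closeUp, hv]
  rw [windExc, windExcTo, h1, wind, windTo, hv, Nat.add_sub_cancel,
    ← Finset.Ico_add_one_right_eq_Icc, Finset.range_eq_Ico]
  refine (Finset.sum_Ico_add' _ 0 n 2).symm.trans ?_
  refine Finset.sum_congr rfl fun j hj => ?_
  rw [Finset.mem_Ico] at hj
  have e : j + 2 - 1 = j + 1 := rfl
  simp only [closeUp, e, List.getD_cons_succ]
  rw [List.getD_append _ _ _ _ (by omega), List.getD_append _ _ _ _ (by omega)]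

lemma mem_steps_iff (a : ℤ × ℤ) : a ∈ steps ↔ ∃ k < 4, a = rot^[k] (1, 1) := by
  constructor
  · intro h
    simp only [steps, Finset.mem_insert, Finset.mem_singleton] at h
    rcases h with rfl | rfl | rfl | rfl
    · exact ⟨0, by simp⟩
    · exact ⟨3, by simp [rot]⟩
    · exact ⟨2, by simp [rot]⟩
    · exact ⟨1, by simp [rot]⟩
  · rintro ⟨k, hk, rfl⟩
    interval_cases k <;> simp [rot, steps]

lemma neg_mem_steps {a : ℤ × ℤ} : -a ∈ steps ↔ a ∈ steps := by
  obtain ⟨x, y⟩ := a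
  simp only [steps, Finset.mem_insert, Finset.mem_singleton, Prod.neg_mk, Prod.mk.injEq]
  omega

lemma isExcursion_closeUp_iff {n : ℕ} {v : List (ℤ × ℤ)} (hv : v.length = n + 1) :
    IsExcursion (closeUp v) ↔ (∃ a ∈ steps, v.head? = some a) ∧
      (∃ b ∈ steps, v.getLast? = some b) ∧ v.IsChain IsDiagStep ∧ ∀ x ∈ v, x ≠ (0, 0) := by
  have hv0 : v ≠ [] := by rintro rfl; simp at hv
  have h1 : (∀ i, 1 ≤ i → i ≤ (closeUp v).length - 2 → (closeUp v).getD i 0 ≠ (0, 0)) ↔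
      ∀ x ∈ v, x ≠ (0, 0) := by
    simp only [closeUp, List.length_cons, List.length_append,
      List.length_nil]
    constructor
    · intro h x hx
      obtain ⟨i, hi, rfl⟩ := List.mem_iff_getElem.1 hx
      have := h (i + 1) (by omega) (by omega)
      rwa [List.getD_cons_succ, List.getD_append _ _ _ _ hi, List.getD_eq_getElem _ _ hi] at this
    · intro h i hi hi'
      obtain ⟨i, rfl⟩ := Nat.exists_eq_add_of_le' hi
      have hi : i < v.length := by omega
      rw [List.getD_cons_succ, List.getD_append _ _ _ _ hi, List.getD_eq_getElem _ _ hi]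
      exact h _ (List.getElem_mem _)
  have h2 : (closeUp v).IsChain IsDiagStep ↔ (∃ a ∈ steps, v.head? = some a) ∧
      (∃ b ∈ steps, v.getLast? = some b) ∧ v.IsChain IsDiagStep := by
    obtain ⟨a, u, rfl⟩ := List.exists_cons_of_ne_nil hv0
    have h3 : closeUp (a :: u) = 0 :: a :: (u ++ [0]) := rfl
    have h4 : a :: (u ++ [0]) = (a :: u) ++ [0] := rfl
    rw [h3, List.isChain_cons_cons, h4, List.isChain_append, isDiagStep_iff, sub_zero]
    rw [List.getLast?_eq_some_getLast hv0]
    simp [isDiagStep_iff, neg_mem_steps]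
    tauto
  change (2 ≤ _ ∧ (closeUp v).IsChain IsDiagStep ∧ _ ∧ _ ∧ _) ↔ _
  rw [h1, h2]
  have h3 : (closeUp v).getLast? = some (0, 0) := by
    change ((0 :: v) ++ [0]).getLast? = _
    rw [List.getLast?_concat]; rfl
  have h4 : 2 ≤ (closeUp v).length := by simp [closeUp]
  have h5 : (closeUp v).head? = some (0, 0) := rfl
  tauto

/-- The excursions of length `n` with winding angle `α`. -/
def excursions (α : ℝ) : ℕ → Finset (List (ℤ × ℤ))
  | n + 2 => ((Finset.range 4).biUnion fun k => orbitWalks n (rot^[k] (1, 1)) (1, 1) α).map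
    ⟨closeUp, closeUp_injective⟩
  | _ => ∅

/-- The number of excursions of length `n` with winding angle `α`. -/
def excursionCnt (α : ℝ) : ℕ → ℝ
  | n + 2 => 4 * cornerCnt n α
  | _ => 0

lemma card_excursions (α : ℝ) (n : ℕ) : ((excursions α n).card : ℝ) = excursionCnt α n := by
  match n with
  | 0 => simp [excursions, excursionCnt]
  | 1 => simp [excursions, excursionCnt]
  | n + 2 =>
    have h11 : ((1, 1) : ℤ × ℤ) ≠ 0 := by decide
    have h : ∀ k, cntOrbit n (rot^[k] (1, 1)) (1, 1) α = cornerCnt n α := by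
      intro k
      induction k with
      | zero => rfl
      | succ k ih => rw [Function.iterate_succ_apply', cntOrbit_rot_left, ih]
    rw [excursions, excursionCnt, Finset.card_map, Finset.card_biUnion]
    · push_cast
      simp_rw [card_orbitWalks n _ h11, h]
      simp
    · intro k hk k' hk' hkk
      rw [Function.onFun, Finset.disjoint_left]
      intro w hw hw'
      obtain ⟨_, -, hw⟩ := mem_orbitWalks.1 hw
      obtain ⟨_, -, hw'⟩ := mem_orbitWalks.1 hw'
      have h := (mem_walks.1 hw).2.1.symm.trans (mem_walks.1 hw').2.1
      exact hkk (rot_iterate_injOn h11 (by simpa using hk) (by simpa using hk')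
        (by simpa using h))

lemma IsExcursion.exists_closeUp {w : List (ℤ × ℤ)} (h : IsExcursion w) :
    ∃ n v, v.length = n + 1 ∧ w = closeUp v := by
  obtain ⟨h1, h2, h3, h4, -⟩ := h
  match w with
  | [] => simp at h3
  | x :: u =>
    obtain rfl : x = 0 := Option.some.inj h3
    rcases List.eq_nil_or_concat' u with rfl | ⟨v, y, rfl⟩
    · simp at h1
    obtain rfl : y = 0 := by
      change ((0 :: v) ++ [y]).getLast? = _ at h4
      rw [List.getLast?_concat] at h4
      exact Option.some.inj h4
    match v with
    | [] =>
      have h5 := (List.isChain_cons_cons.1 h2).1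
      rw [isDiagStep_iff] at h5
      exact absurd h5 (by decide)
    | z :: v => exact ⟨v.length, z :: v, rfl, rfl⟩

lemma mem_excursions {α : ℝ} {n : ℕ} {w : List (ℤ × ℤ)} :
    w ∈ excursions α n ↔ (IsExcursion w ∧ windExc w = α) ∧ w.length - 1 = n := by
  constructor
  · match n with
    | 0 => simp [excursions]
    | 1 => simp [excursions]
    | n + 2 =>
      simp only [excursions, Finset.mem_map, Finset.mem_biUnion, Finset.mem_range, mem_orbitWalks,
        Function.Embedding.coeFn_mk]
      rintro ⟨v, ⟨k, hk, k', hk', hv⟩, rfl⟩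
      obtain ⟨h1, h2, h3, h4, h5, h6⟩ := mem_walks.1 hv
      rw [isExcursion_closeUp_iff h1, windExc_closeUp h1]
      exact ⟨⟨⟨⟨_, (mem_steps_iff _).2 ⟨k, hk, rfl⟩, h2⟩, ⟨_, (mem_steps_iff _).2 ⟨k', hk', rfl⟩, h3⟩,
        h4, h5⟩, h6⟩, by simp [closeUp, h1]⟩
  · rintro ⟨⟨h, hα⟩, rfl⟩
    obtain ⟨n, v, hv, rfl⟩ := h.exists_closeUp
    have hl : (closeUp v).length - 1 = n + 2 := by simp [closeUp, hv]
    rw [hl]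
    rw [windExc_closeUp hv] at hα
    obtain ⟨⟨a, ha, h1⟩, ⟨b, hb, h2⟩, h3, h4⟩ := (isExcursion_closeUp_iff hv).1 h
    obtain ⟨k, hk, rfl⟩ := (mem_steps_iff _).1 ha
    obtain ⟨k', hk', rfl⟩ := (mem_steps_iff _).1 hb
    simp only [excursions, Finset.mem_map, Finset.mem_biUnion, Finset.mem_range, mem_orbitWalks,
      Function.Embedding.coeFn_mk]
    exact ⟨v, ⟨k, hk, k', hk', mem_walks.2 ⟨hv, h1, h2, h3, h4, hα⟩⟩, rfl⟩

lemma Fgen_eq {t : ℝ} (ht : t ∈ Set.Ioo (0 : ℝ) (1 / 4)) (α : ℝ) :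
    Fgen t α = ∑' n, excursionCnt α n * t ^ n := by
  refine tsum_pow_length t ht.1.le _ _ (excursions α) (fun _ _ => mem_excursions)
    (card_excursions α) (summable_mul_pow_of_le ht 1 (fun n => ?_) fun n => ?_)
  · rw [← card_excursions]; positivity
  · match n with
    | 0 => simp [excursionCnt]
    | 1 => simp [excursionCnt]
    | n + 2 =>
      have h := cntOrbit_le n (1, 1) (1, 1) α
      rw [← cornerCnt] at h
      rw [excursionCnt, pow_add]
      linarith

lemma four_mul_tsum_seriesTerm (t α : ℝ) (n : ℕ) :
    4 * ∑' x, seriesTerm t |α| n x = excursionCnt α n * t ^ n := by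
  match n with
  | 0 => rw [tsum_seriesTerm_of_lt (abs_nonneg α) (by norm_num)]; simp [excursionCnt]
  | 1 => rw [tsum_seriesTerm_of_lt (abs_nonneg α) (by norm_num)]; simp [excursionCnt]
  | n + 2 =>
    have h : cornerCnt n |α| = cornerCnt n α := by
      rcases abs_choice α with h | h <;> rw [h]
      exact cornerCnt_neg n α
    rw [tsum_seriesTerm_add_two (abs_nonneg α), excursionCnt, h, mul_assoc]

/-- Lemma 11: for `t ∈ (0,1/4)` and `α ∈ (π/2)ℤ`,
`F^{(α)}(t) = 4 Σ_{m,l,p≥1} (-1)^{l+p+m+1} m W^{(|α|+mπ/2)}_{2l,2p}(t)`,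
the triple sum converging absolutely. -/
theorem statement8 (t : ℝ) (ht : t ∈ Set.Ioo (0 : ℝ) (1 / 4))
    (ja : ℤ) (α : ℝ) (hα : α = π / 2 * ja) :
    Summable (fun x : ℕ × ℕ × ℕ =>
      (-1 : ℝ) ^ ((x.2.1 + 1) + (x.2.2 + 1) + (x.1 + 1) + 1) * ((x.1 : ℝ) + 1) *
        Wgen t (2 * (x.2.1 + 1)) (2 * (x.2.2 + 1)) (|α| + (x.1 + 1) * π / 2) Set.univ) ∧
    Fgen t α = 4 * ∑' x : ℕ × ℕ × ℕ,
      (-1 : ℝ) ^ ((x.2.1 + 1) + (x.2.2 + 1) + (x.1 + 1) + 1) * ((x.1 : ℝ) + 1) *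
        Wgen t (2 * (x.2.1 + 1)) (2 * (x.2.2 + 1)) (|α| + (x.1 + 1) * π / 2) Set.univ := by
  have hS : Summable (Function.uncurry (seriesTerm t |α|)) :=
    summable_seriesTerm ht (abs_nonneg α)
  have hW : ∀ x : ℕ × ℕ × ℕ, (-1 : ℝ) ^ ((x.2.1 + 1) + (x.2.2 + 1) + (x.1 + 1) + 1) *
      ((x.1 : ℝ) + 1) *
        Wgen t (2 * (x.2.1 + 1)) (2 * (x.2.2 + 1)) (|α| + (x.1 + 1) * π / 2) Set.univ =
      ∑' n, seriesTerm t |α| n x := fun x => by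
    rw [Wgen_eq ht, ← tsum_mul_left]
    rfl
  simp_rw [hW]
  refine ⟨hS.prod_symm.prod, ?_⟩
  rw [hS.tsum_comm, ← tsum_mul_left, Fgen_eq ht]
  exact tsum_congr fun n => (four_mul_tsum_seriesTerm t α n).symm

end
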